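/- arXiv:1605.01280 — 2 statements merged into one kernel-verified Lean document; each statement's English description precedes it below -/
import Mathlib

section
/- Let n be a positive integer with n ≤ 6, r_1, …, r_n positive integers, and k an integer with 1 ≤ k ≤ n. Assume r_1 = r_n = 1, 0 ≤ r_{i+1} − r_i ≤ 1 for all 1 ≤ i < k, and 0 ≤ r_i − r_{i+1} ≤ 1 for all k ≤ i ≤ n−1. Then the data (r_1, …, r_n; k), or its reversal (r_n, …, r_1; n+1−k), satisfies one of the following six cases: (1) k = n = 1 and r_1 = 1; (2) k ≥ 2 and r_1 = r_2 = 1; (3) k = 2, n ≥ 3, and r_1 = 1, r_2 = 2, r_3 = 1; (4) k ≥ 3 and r_1 = 1, r_2 = r_3 = 2; (5) k = 3, n = 5, and (r_1, …, r_5) = (1,2,3,2,1); (6) k = 4, n = 6, and (r_1, …, r_6) = (1,2,3,3,2,1). -/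
/-- The six cases of the classification: (1) `k = n = 1` and `r 1 = 1`;
(2) `k ≥ 2` and `r 1 = r 2 = 1`; (3) `k = 2`, `n ≥ 3` and `(r 1, r 2, r 3) = (1, 2, 1)`;
(4) `k ≥ 3` and `r 1 = 1`, `r 2 = r 3 = 2`; (5) `k = 3`, `n = 5` and
`(r 1, …, r 5) = (1,2,3,2,1)`; (6) `k = 4`, `n = 6` and `(r 1, …, r 6) = (1,2,3,3,2,1)`. -/
def SixCases (n : ℕ) (r : ℕ → ℤ) (k : ℕ) : Prop :=
  (k = 1 ∧ n = 1 ∧ r 1 = 1)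
  ∨ (2 ≤ k ∧ r 1 = 1 ∧ r 2 = 1)
  ∨ (k = 2 ∧ 3 ≤ n ∧ r 1 = 1 ∧ r 2 = 2 ∧ r 3 = 1)
  ∨ (3 ≤ k ∧ r 1 = 1 ∧ r 2 = 2 ∧ r 3 = 2)
  ∨ (k = 3 ∧ n = 5 ∧ r 1 = 1 ∧ r 2 = 2 ∧ r 3 = 3 ∧ r 4 = 2 ∧ r 5 = 1)
  ∨ (k = 4 ∧ n = 6 ∧ r 1 = 1 ∧ r 2 = 2 ∧ r 3 = 3 ∧ r 4 = 3 ∧ r 5 = 2 ∧ r 6 = 1)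

/-- For `n ≤ 6`, under the equality conditions for `f(r₁,…,rₙ;k) = 0`, the data
`(r₁,…,rₙ;k)` or its reversal `(rₙ,…,r₁; n+1−k)` satisfies one of the six cases. -/
theorem six_cases (n : ℕ) (hn : 1 ≤ n) (hn6 : n ≤ 6) (r : ℕ → ℤ)
    (hr : ∀ i, 1 ≤ i → i ≤ n → 0 < r i)
    (k : ℕ) (hk1 : 1 ≤ k) (hkn : k ≤ n)
    (h1 : r 1 = 1) (h2 : r n = 1)
    (h3 : ∀ i, 1 ≤ i → i < k → 0 ≤ r (i + 1) - r i ∧ r (i + 1) - r i ≤ 1)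
    (h4 : ∀ i, k ≤ i → i + 1 ≤ n → 0 ≤ r i - r (i + 1) ∧ r i - r (i + 1) ≤ 1) :
    SixCases n r k ∨ SixCases n (fun i => r (n + 1 - i)) (n + 1 - k) := by
  have a1 := h3 1
  have a2 := h3 2
  have a3 := h3 3
  have a4 := h3 4
  have a5 := h3 5
  have b1 := h4 1
  have b2 := h4 2
  have b3 := h4 3
  have b4 := h4 4
  have b5 := h4 5
  clear h3 h4 hr
  unfold SixCases
  interval_cases n <;> interval_cases k <;> norm_num at * <;> omega
end

section
/- Let 0 → G2 → R → G1 → 0 be a short exact sequence in C such that Ext^n(X,Y) = 0 for all n ≥ 3 and all X, Y ∈ {G1, G2, R}. If h^1(R,R) = 0, h^0(G2,G1) = 0, and h^2(G1,G2) = 0, then h^2(R,R) = h^2(G1,G1) + h^2(G2,G2) + χ(G2,G1) (Mukai's lemma, part (3)). -/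
open CategoryTheory Opposite

/-- `hdim C n X Y = dim_ℂ Ext^n(X, Y)` in a ℂ-linear abelian category `C`. -/
noncomputable def hdim (C : Type*) [Category C] [Abelian C] [Linear ℂ C]
    [EnoughProjectives C] (n : ℕ) (X Y : C) : ℕ :=
  Module.finrank ℂ (((Ext ℂ C n).obj (op X)).obj Y)

/-- The Euler characteristic `χ(X,Y) = h⁰(X,Y) − h¹(X,Y) + h²(X,Y)`. -/
noncomputable def eulerChi (C : Type*) [Category C] [Abelian C] [Linear ℂ C]
    [EnoughProjectives C] (X Y : C) : ℤ :=
  (hdim C 0 X Y : ℤ) - (hdim C 1 X Y : ℤ) + (hdim C 2 X Y : ℤ)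

namespace CategoryTheory.Abelian.Ext

variable (k : Type*) [Field k] {C : Type*} [Category C] [Abelian C] [Linear k C] [HasExt C]
  {S : ShortComplex C}

lemma exact_postcompOfLinear_f_g (hS : S.ShortExact) (X : C) (n : ℕ) :
    Function.Exact ((mk₀ S.f).postcompOfLinear k X (add_zero n))
      ((mk₀ S.g).postcompOfLinear k X (add_zero n)) :=
  (ShortComplex.ab_exact_iff_function_exact _).1 (covariant_sequence_exact₂' X hS n)

lemma exact_postcompOfLinear_g_extClass (hS : S.ShortExact) (X : C) {n₀ n₁ : ℕ}
    (h : n₀ + 1 = n₁) :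
    Function.Exact ((mk₀ S.g).postcompOfLinear k X (add_zero n₀))
      (hS.extClass.postcompOfLinear k X h) :=
  (ShortComplex.ab_exact_iff_function_exact _).1 (covariant_sequence_exact₃' X hS n₀ n₁ h)

lemma exact_postcompOfLinear_extClass_f (hS : S.ShortExact) (X : C) {n₀ n₁ : ℕ}
    (h : n₀ + 1 = n₁) :
    Function.Exact (hS.extClass.postcompOfLinear k X h)
      ((mk₀ S.f).postcompOfLinear k X (add_zero n₁)) :=
  (ShortComplex.ab_exact_iff_function_exact _).1 (covariant_sequence_exact₁' X hS n₀ n₁ h)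

lemma exact_precompOfLinear_g_f (hS : S.ShortExact) (Y : C) (n : ℕ) :
    Function.Exact ((mk₀ S.g).precompOfLinear k Y (zero_add n))
      ((mk₀ S.f).precompOfLinear k Y (zero_add n)) :=
  (ShortComplex.ab_exact_iff_function_exact _).1 (contravariant_sequence_exact₂' hS Y n)

lemma exact_precompOfLinear_f_extClass (hS : S.ShortExact) (Y : C) {n₀ n₁ : ℕ}
    (h : 1 + n₀ = n₁) :
    Function.Exact ((mk₀ S.f).precompOfLinear k Y (zero_add n₀))
      (hS.extClass.precompOfLinear k Y h) :=
  (ShortComplex.ab_exact_iff_function_exact _).1 (contravariant_sequence_exact₁' hS Y n₀ n₁ h)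

lemma exact_precompOfLinear_extClass_g (hS : S.ShortExact) (Y : C) {n₀ n₁ : ℕ}
    (h : 1 + n₀ = n₁) :
    Function.Exact (hS.extClass.precompOfLinear k Y h)
      ((mk₀ S.g).precompOfLinear k Y (zero_add n₁)) :=
  (ShortComplex.ab_exact_iff_function_exact _).1 (contravariant_sequence_exact₃' hS Y n₀ n₁ h)

end CategoryTheory.Abelian.Ext

lemma Function.Exact.finrank_eq_add_finrank_range {k U V W : Type*} [Field k]
    [AddCommGroup U] [Module k U] [AddCommGroup V] [Module k V] [AddCommGroup W] [Module k W]
    [FiniteDimensional k V] {f : U →ₗ[k] V} {g : V →ₗ[k] W} (h : Function.Exact f g) :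
    Module.finrank k V = Module.finrank k f.range + Module.finrank k g.range := by
  rw [← g.finrank_range_add_finrank_ker, h.linearMap_ker_eq, add_comm]

lemma LinearMap.finrank_range_eq_zero_of_subsingleton {k V W : Type*} [Field k]
    [AddCommGroup V] [Module k V] [AddCommGroup W] [Module k W] (f : V →ₗ[k] W)
    (h : Subsingleton V ∨ Subsingleton W) : Module.finrank k f.range = 0 := by
  obtain rfl : f = 0 := by
    rcases h with h | h <;> exact Subsingleton.elim _ _
  rw [LinearMap.range_zero, finrank_bot]

namespace CategoryTheory.ShortComplex.ShortExact

open Abelian Ext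

/-- A form of Mukai's lemma: if `Ext¹(S.X₂, S.X₂)`, `Hom(S.X₁, S.X₃)` and `Ext²(S.X₃, S.X₁)`
vanish, then `Ext¹(S.X₃, S.X₃)` vanishes. -/
lemma subsingleton_ext_one {C : Type*} [Category C] [Abelian C] [HasExt C]
    {S : ShortComplex C} (hS : S.ShortExact)
    (h₂₂ : Subsingleton (Abelian.Ext S.X₂ S.X₂ 1)) (h₁₃ : Subsingleton (Abelian.Ext S.X₁ S.X₃ 0))
    (h₃₁ : Subsingleton (Abelian.Ext S.X₃ S.X₁ 2)) : Subsingleton (Abelian.Ext S.X₃ S.X₃ 1) := by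
  refine subsingleton_of_forall_eq 0 fun x ↦ ?_
  obtain ⟨y, hy⟩ := covariant_sequence_exact₃ _ hS ((mk₀ S.g).comp x (zero_add 1))
    (n₁ := 2) rfl (by
      rw [comp_assoc _ _ _ (zero_add 1) (by rfl : 1 + 1 = 2) (by rfl),
        Subsingleton.elim (x.comp hS.extClass (by rfl : 1 + 1 = 2)) 0, comp_zero])
  rw [Subsingleton.elim y 0, zero_comp] at hy
  obtain ⟨z, rfl⟩ := contravariant_sequence_exact₃ hS _ x hy.symm (n₀ := 0) rfl
  rw [Subsingleton.elim z 0, comp_zero]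

/-- Mukai's lemma, for the `Ext`-groups defined using the derived category. -/
lemma finrank_ext_two (k : Type*) [Field k] {C : Type*} [Category C] [Abelian C] [Linear k C]
    [HasExt C] {S : ShortComplex C} (hS : S.ShortExact)
    (hfin : ∀ (n : ℕ) (X Y : C), FiniteDimensional k (Abelian.Ext X Y n))
    (h₂₁ : Subsingleton (Abelian.Ext S.X₂ S.X₁ 3)) (h₃₁ : Subsingleton (Abelian.Ext S.X₃ S.X₁ 3))
    (h₃₃ : Subsingleton (Abelian.Ext S.X₃ S.X₃ 3))
    (h₂₂ : Subsingleton (Abelian.Ext S.X₂ S.X₂ 1)) (h₁₃ : Subsingleton (Abelian.Ext S.X₁ S.X₃ 0))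
    (h₃₁' : Subsingleton (Abelian.Ext S.X₃ S.X₁ 2)) :
    Module.finrank k (Abelian.Ext S.X₂ S.X₂ 2) + Module.finrank k (Abelian.Ext S.X₁ S.X₃ 1) =
      Module.finrank k (Abelian.Ext S.X₃ S.X₃ 2) + Module.finrank k (Abelian.Ext S.X₁ S.X₁ 2) +
        Module.finrank k (Abelian.Ext S.X₁ S.X₃ 2) := by
  have h₃₃' := hS.subsingleton_ext_one h₂₂ h₁₃ h₃₁'
  have a₁ := (exact_precompOfLinear_g_f k hS S.X₁ 2).finrank_eq_add_finrank_range
  have a₂ := (exact_precompOfLinear_f_extClass k hS S.X₁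
    (n₀ := 2) (n₁ := 3) rfl).finrank_eq_add_finrank_range
  rw [LinearMap.finrank_range_eq_zero_of_subsingleton _ (.inl h₃₁')] at a₁
  rw [LinearMap.finrank_range_eq_zero_of_subsingleton
    (hS.extClass.precompOfLinear _ _ _) (.inr h₃₁)] at a₂
  have b₁ := (exact_postcompOfLinear_g_extClass k hS S.X₂
    (n₀ := 1) (n₁ := 2) rfl).finrank_eq_add_finrank_range
  have b₂ := (exact_postcompOfLinear_extClass_f k hS S.X₂
    (n₀ := 1) (n₁ := 2) rfl).finrank_eq_add_finrank_range
  have b₃ := (exact_postcompOfLinear_f_g k hS S.X₂ 2).finrank_eq_add_finrank_range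
  have b₄ := (exact_postcompOfLinear_g_extClass k hS S.X₂
    (n₀ := 2) (n₁ := 3) rfl).finrank_eq_add_finrank_range
  rw [LinearMap.finrank_range_eq_zero_of_subsingleton _ (.inl h₂₂)] at b₁
  rw [LinearMap.finrank_range_eq_zero_of_subsingleton
    (hS.extClass.postcompOfLinear _ _ _) (.inr h₂₁)] at b₄
  have c₁ := (exact_precompOfLinear_g_f k hS S.X₃ 1).finrank_eq_add_finrank_range
  have c₂ := (exact_precompOfLinear_f_extClass k hS S.X₃
    (n₀ := 1) (n₁ := 2) rfl).finrank_eq_add_finrank_range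
  have c₃ := (exact_precompOfLinear_extClass_g k hS S.X₃
    (n₀ := 1) (n₁ := 2) rfl).finrank_eq_add_finrank_range
  have c₄ := (exact_precompOfLinear_g_f k hS S.X₃ 2).finrank_eq_add_finrank_range
  have c₅ := (exact_precompOfLinear_f_extClass k hS S.X₃
    (n₀ := 2) (n₁ := 3) rfl).finrank_eq_add_finrank_range
  rw [LinearMap.finrank_range_eq_zero_of_subsingleton _ (.inl h₃₃')] at c₁
  rw [LinearMap.finrank_range_eq_zero_of_subsingleton
    (hS.extClass.precompOfLinear _ _ _) (.inr h₃₃)] at c₅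
  lia

end CategoryTheory.ShortComplex.ShortExact

namespace CategoryTheory.ProjectiveResolution

open Abelian CochainComplex.HomComplex

variable {C : Type*} [Category C] [Abelian C] [HasExt C] {X Y : C} (P : ProjectiveResolution X)

lemma extMk_degree_zero_eq_zero_iff (f : P.complex.X 0 ⟶ Y) (m : ℕ) (hm : 0 + 1 = m)
    (hf : P.complex.d m 0 ≫ f = 0) : P.extMk f m hm hf = 0 ↔ f = 0 := by
  refine ⟨fun h ↦ ?_, fun h ↦ by subst h; simp⟩
  rw [← P.extEquivCohomologyClass.apply_eq_iff_eq, extEquivCohomologyClass_extMk,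
    extEquivCohomologyClass_zero, CohomologyClass.mk_eq_zero_iff,
    Cocycle.toSingleMk_mem_coboundaries_iff _ _ _ _ _ 1 (by lia)] at h
  obtain ⟨g, hg⟩ := h
  have hz : Limits.IsZero (P.cochainComplex.X 1) := P.cochainComplex.isZero_of_isStrictlyLE 0 1
  rw [hz.eq_of_src g 0, Limits.comp_zero] at hg
  rw [← cancel_epi (P.cochainComplexXIso (-(0 : ℕ)) 0 rfl).hom, ← hg, Limits.comp_zero]

lemma extMk_eq_zero_iff_exists_prev {n : ℕ} (f : P.complex.X n ⟶ Y) (m : ℕ) (hm : n + 1 = m)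
    (hf : P.complex.d m n ≫ f = 0) : P.extMk f m hm hf = 0 ↔
      ∃ g : P.complex.X ((ComplexShape.up ℕ).prev n) ⟶ Y, P.complex.d n _ ≫ g = f := by
  cases n with
  | zero =>
    rw [extMk_degree_zero_eq_zero_iff, P.complex.shape _ _ (by simp)]
    simp [eq_comm]
  | succ n => exact P.extMk_eq_zero_iff _ _ _ _ _ (by simp)

lemma smul_extMk {k : Type*} [Ring k] [Linear k C] {n : ℕ} (r : k) (f : P.complex.X n ⟶ Y)
    (m : ℕ) (hm : n + 1 = m) (hf : P.complex.d m n ≫ f = 0) :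
    r • P.extMk f m hm hf = P.extMk (r • f) m hm (by simp [hf]) := by
  rw [Ext.smul_eq_comp_mk₀, extMk_comp_mk₀]
  congr 1
  simp

variable (Y) (k : Type*) [Ring k] [Linear k C]

/-- The linear map from `n`-cocycles to `Ext X Y n` attached to a projective resolution. -/
noncomputable def extMkLinear (n : ℕ) :
    ((P.complex.linearYonedaObj k Y).sc n).g.hom.ker →ₗ[k] Abelian.Ext X Y n where
  toFun f := P.extMk (n := n) (Y := Y) f.1 ((ComplexShape.up ℕ).next n) (by simp) f.2
  map_add' f g := (P.add_extMk _ _ _ _ _ _).symm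
  map_smul' r f := (P.smul_extMk _ _ _ _ _).symm

lemma extMkLinear_surjective (n : ℕ) : Function.Surjective (P.extMkLinear Y k n) := fun x ↦ by
  obtain ⟨f, hf, rfl⟩ := P.extMk_surjective x ((ComplexShape.up ℕ).next n) (by simp)
  exact ⟨⟨f, hf⟩, rfl⟩

lemma ker_extMkLinear (n : ℕ) : (P.extMkLinear Y k n).ker =
    ((P.complex.linearYonedaObj k Y).sc n).moduleCatToCycles.range := by
  ext ⟨f, hf⟩
  exact (P.extMk_eq_zero_iff_exists_prev (n := n) (Y := Y) f _ (by simp) hf).trans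
    (exists_congr fun g ↦
      (Subtype.ext_iff (a1 := ((P.complex.linearYonedaObj k Y).sc n).moduleCatToCycles g)
        (a2 := ⟨f, hf⟩)).symm)

/-- The two definitions of `Ext` agree in a linear abelian category with enough projectives. -/
noncomputable def extLinearEquiv [EnoughProjectives C] (n : ℕ) :
    ((_root_.Ext k C n).obj (op X)).obj Y ≃ₗ[k] Abelian.Ext X Y n :=
  (P.isoExt n Y ≪≫ ((P.complex.linearYonedaObj k Y).sc n).moduleCatHomologyIso).toLinearEquiv ≪≫ₗ
    Submodule.quotEquivOfEq _ _ (P.ker_extMkLinear Y k n).symm ≪≫ₗ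
    (P.extMkLinear Y k n).quotKerEquivOfSurjective (P.extMkLinear_surjective Y k n)

end CategoryTheory.ProjectiveResolution

/-- Mukai's lemma, part (3): for a short exact sequence `0 → G2 → R → G1 → 0` with
`Ext^n(X,Y) = 0` for `n ≥ 3` and `X, Y ∈ {G1, G2, R}`, if `h¹(R,R) = 0`, `h⁰(G2,G1) = 0`
and `h²(G1,G2) = 0`, then `h²(R,R) = h²(G1,G1) + h²(G2,G2) + χ(G2,G1)`. -/
theorem mukai_three {C : Type*} [Category C] [Abelian C] [Linear ℂ C] [EnoughProjectives C]
    (hfin : ∀ (n : ℕ) (X Y : C), FiniteDimensional ℂ (((Ext ℂ C n).obj (op X)).obj Y))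
    (G1 G2 R : C) (f : G2 ⟶ R) (g : R ⟶ G1) (w : f ≫ g = 0)
    (hexact : (ShortComplex.mk f g w).ShortExact)
    (hvanish : ∀ (n : ℕ), 3 ≤ n → ∀ X Y : C, (X = G1 ∨ X = G2 ∨ X = R) →
      (Y = G1 ∨ Y = G2 ∨ Y = R) → Subsingleton (((Ext ℂ C n).obj (op X)).obj Y))
    (hRR : hdim C 1 R R = 0) (hG2G1 : hdim C 0 G2 G1 = 0) (hG1G2 : hdim C 2 G1 G2 = 0) :
    (hdim C 2 R R : ℤ) = (hdim C 2 G1 G1 : ℤ) + (hdim C 2 G2 G2 : ℤ) + eulerChi C G2 G1 := by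
  have := HasExt.standard C
  have e (X Y : C) (n : ℕ) : ((Ext ℂ C n).obj (op X)).obj Y ≃ₗ[ℂ] Abelian.Ext X Y n :=
    (projectiveResolution X).extLinearEquiv Y ℂ n
  have hdim_eq (n : ℕ) (X Y : C) : hdim C n X Y = Module.finrank ℂ (Abelian.Ext X Y n) :=
    (e X Y n).finrank_eq
  have hfin' (n : ℕ) (X Y : C) : FiniteDimensional ℂ (Abelian.Ext X Y n) :=
    (e X Y n).finiteDimensional
  have hvanish' (X Y : C) (hX : X = G1 ∨ X = G2 ∨ X = R) (hY : Y = G1 ∨ Y = G2 ∨ Y = R) :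
      Subsingleton (Abelian.Ext X Y 3) :=
    have := hvanish 3 le_rfl X Y hX hY
    (e X Y 3).symm.subsingleton
  have hzero {n : ℕ} {X Y : C} (h : hdim C n X Y = 0) : Subsingleton (Abelian.Ext X Y n) :=
    Module.finrank_zero_iff.1 ((hdim_eq n X Y).symm.trans h)
  have key := hexact.finrank_ext_two ℂ hfin' (hvanish' R G2 (by simp) (by simp))
    (hvanish' G1 G2 (by simp) (by simp)) (hvanish' G1 G1 (by simp) (by simp))
    (hzero hRR) (hzero hG2G1) (hzero hG1G2)
  simp only [← hdim_eq] at key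
  simp only [eulerChi, hG2G1]
  lia
end
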